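/- arXiv:2308.11997 — 2 statements merged into one kernel-verified Lean document; each statement's English description precedes it below -/
import Mathlib

section
/- Let γ be a Jordan curve in ℂ (a homeomorphic image of the circle) with trace K = tr γ. Then ℂ \ K has exactly two connected components, one bounded (the interior int γ) and one unbounded (the exterior ext γ), and K = ∂(int γ) = ∂(ext γ). -/
open Bornology Set Topology

section Log

/-- Two continuous logarithms of the same function differ by a constant on a preconnected set. -/
theorem IsPreconnected.sub_eq_sub_of_exp_eq {X : Type*} [TopologicalSpace X] {S : Set X}
    (hS : IsPreconnected S) {f g : X → ℂ} (hf : ContinuousOn f S) (hg : ContinuousOn g S)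
    (h : ∀ x ∈ S, Complex.exp (f x) = Complex.exp (g x)) {x y : X} (hx : x ∈ S) (hy : y ∈ S) :
    f x - g x = f y - g y := by
  have hd : DiscreteTopology (AddSubgroup.zmultiples (2 * Real.pi * Complex.I) : Set ℂ) :=
    NormedSpace.discreteTopology_zmultiples (2 * Real.pi * Complex.I)
  refine hS.constant_of_mapsTo (f := fun z ↦ f z - g z)
    (T := (AddSubgroup.zmultiples (2 * Real.pi * Complex.I) : Set ℂ)) ⟨hd⟩ (hf.sub hg)
    (fun z hz ↦ ?_) hx hy
  obtain ⟨n, hn⟩ := Complex.exp_eq_exp_iff_exists_int.1 (h z hz)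
  exact AddSubgroup.mem_zmultiples_iff.2 ⟨n, by simp [hn]⟩

theorem Continuous.exists_exp_eq {X : Type*} [TopologicalSpace X] [SimplyConnectedSpace X]
    [LocallyPathConnectedSpace X] {f : X → ℂ} (hf : Continuous f) (h0 : ∀ x, f x ≠ 0) :
    ∃ g : X → ℂ, Continuous g ∧ ∀ x, Complex.exp (g x) = f x := by
  have x₀ : X := Classical.arbitrary X
  obtain ⟨g, ⟨-, hg⟩, -⟩ := Complex.isCoveringMapOn_exp.existsUnique_continuousMap_lifts
    ⟨f, hf⟩ (Complex.exp_log (h0 x₀)) h0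
  exact ⟨g, g.continuous, fun x ↦ congrFun hg x⟩

/-- A continuous logarithm of `t ↦ c * exp (i m t)` which takes the same value at `0` and at `2π`
forces `m = 0`. -/
theorem eq_zero_of_exp_eq_circle {m : ℤ} {c : ℂ} {u : ℝ → ℂ} (hu : Continuous u)
    (h : ∀ t : ℝ, Complex.exp (u t) = c * Complex.exp (m * (t * Complex.I)))
    (h2 : u (2 * Real.pi) = u 0) : m = 0 := by
  have h0 : Complex.exp (u 0) = c := by simpa using h 0
  have key := isPreconnected_univ.sub_eq_sub_of_exp_eq (f := u)
    (g := fun t : ℝ ↦ u 0 + m * (t * Complex.I)) hu.continuousOn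
    (by fun_prop) (fun t _ ↦ by rw [h, Complex.exp_add, h0]) (mem_univ (2 * Real.pi)) (mem_univ 0)
  rw [h2] at key
  simpa [Real.pi_ne_zero, Complex.I_ne_zero] using key

/-- If `e` is a closed embedding whose range contains the frontier of a bounded open set `U`, and
`(z - p) ^ m * (z - q) ^ n` has a continuous logarithm along `e`, with `p ∈ U` and `q ∉ U`, then
`m = 0`. -/
theorem Topology.IsClosedEmbedding.exponent_eq_zero {X : Type*} [TopologicalSpace X] {e : X → ℂ}
    (he : IsClosedEmbedding e) {U : Set ℂ} (hUo : IsOpen U) (hUb : IsBounded U)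
    (hfr : frontier U ⊆ range e) {p q : ℂ} (hp : p ∈ U) (hq : q ∉ U)
    (hqe : q ∉ range e) {m n : ℤ} {g : X → ℂ} (hg : Continuous g)
    (h : ∀ x, Complex.exp (g x) = (e x - p) ^ m * (e x - q) ^ n) : m = 0 := by
  classical
  obtain ⟨G, hG⟩ := ContinuousMap.exists_extension' (Y := ℂ) he ⟨g, hg⟩
  have hGe : ∀ x, G (e x) = g x := fun x ↦ congrFun hG x
  have hqc : q ∉ closure U := by
    rw [closure_eq_self_union_frontier]
    exact fun hh ↦ hh.elim hq fun h' ↦ hqe (hfr h')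
  have hcl : closure {x | ¬ x ∈ U} = Uᶜ := hUo.isClosed_compl.closure_eq
  obtain ⟨H, hH, hHe⟩ := Continuous.exists_exp_eq
    (f := fun z ↦ if z ∈ U then Complex.exp (G z) * ((z - q) ^ n)⁻¹ else (z - p) ^ m)
    (by
      refine continuous_if ?_ ?_ ?_
      · intro a ha
        obtain ⟨x, rfl⟩ := hfr ha
        have : e x - q ≠ 0 := sub_ne_zero.2 fun hh ↦ hqe ⟨x, hh⟩
        rw [hGe, h, mul_assoc, mul_inv_cancel₀ (zpow_ne_zero _ this), mul_one]
      · intro z hz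
        have : z - q ≠ 0 := sub_ne_zero.2 fun hh ↦ hqc (hh ▸ hz)
        have h2 : ContinuousAt (fun z : ℂ ↦ (z - q) ^ n) z :=
          (by fun_prop : ContinuousAt (fun z : ℂ ↦ z - q) z).zpow₀ _ (.inl this)
        exact ((by fun_prop : ContinuousAt (fun z : ℂ ↦ Complex.exp (G z)) z).mul
          (h2.inv₀ (zpow_ne_zero _ this))).continuousWithinAt
      · rw [hcl]
        intro z hz
        have : z - p ≠ 0 := sub_ne_zero.2 fun hh ↦ hz (hh ▸ hp)
        exact ((by fun_prop : ContinuousAt (fun z : ℂ ↦ z - p) z).zpow₀ _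
          (.inl this)).continuousWithinAt)
    (by
      intro z
      split_ifs with hz
      · have : z - q ≠ 0 := sub_ne_zero.2 fun hh ↦ hq (hh ▸ hz)
        exact mul_ne_zero (Complex.exp_ne_zero _) (inv_ne_zero (zpow_ne_zero _ this))
      · have : z - p ≠ 0 := sub_ne_zero.2 fun hh ↦ hz (hh ▸ hp)
        exact zpow_ne_zero _ this)
  obtain ⟨R, hR0, hR⟩ := hUb.subset_ball_lt 0 p
  refine eq_zero_of_exp_eq_circle (m := m) (c := (R : ℂ) ^ m)
    (u := fun t : ℝ ↦ H (p + R * Complex.exp (t * Complex.I))) (by fun_prop) (fun t ↦ ?_) (by simp)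
  have hnot : p + R * Complex.exp (t * Complex.I) ∉ U := fun hh ↦ by
    have := hR hh
    simp [dist_eq_norm, Complex.norm_exp_ofReal_mul_I, abs_of_pos hR0] at this
  rw [hHe, if_neg hnot, add_sub_cancel_left, mul_zpow, Complex.exp_int_mul]

/-- Along a path `c`, the function `(z - c 1) / (z - c 0)` has a continuous logarithm off the
trace of `c`. -/
theorem exists_exp_eq_div_compl_range (c : C(unitInterval, ℂ)) :
    ∃ L : ℂ → ℂ, ContinuousOn L (range c)ᶜ ∧
      ∀ z ∈ (range c)ᶜ, Complex.exp (L z) = (z - c 1) / (z - c 0) := by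
  classical
  let A := ((range c)ᶜ : Set ℂ)
  have hne : ∀ (z : A) t, (z : ℂ) - c t ≠ 0 := fun z t ↦
    sub_ne_zero.2 fun hh ↦ z.2 ⟨t, hh.symm⟩
  let H : C(unitInterval × A, {z : ℂ // z ≠ 0}) :=
    ⟨fun x ↦ ⟨(x.2 - c x.1) / (x.2 - c 0), div_ne_zero (hne _ _) (hne _ _)⟩, by
      refine Continuous.subtype_mk (.div (by fun_prop) (by fun_prop) fun x ↦ hne _ _) _⟩
  have H0 : ∀ a, H (0, a) = ⟨_, Complex.exp_ne_zero ((ContinuousMap.const A (0 : ℂ)) a)⟩ :=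
    fun a ↦ Subtype.ext (by simp [H, div_self (hne a 0)])
  let F := Complex.isCoveringMap_exp.liftHomotopy H (.const A 0) H0
  have hF : ∀ x, Complex.exp (F x) = H x := fun x ↦
    congrArg Subtype.val (congrFun (Complex.isCoveringMap_exp.liftHomotopy_lifts H _ H0) x)
  refine ⟨fun z ↦ if hz : z ∈ A then F (1, ⟨z, hz⟩) else 0, ?_, fun z hz ↦ ?_⟩
  · rw [continuousOn_iff_continuous_domRestrict]
    have : Continuous fun z : A ↦ F (1, z) := by fun_prop
    convert this using 1
    ext z
    exact dif_pos z.2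
  · exact (congrArg Complex.exp (dif_pos hz)).trans (hF _)

end Log

section Components

theorem IsOpen.frontier_connectedComponentIn_subset {X : Type*} [TopologicalSpace X]
    [LocallyConnectedSpace X] {F : Set X} (hF : IsOpen F) (x : X) :
    frontier (connectedComponentIn F x) ⊆ Fᶜ := by
  intro y hy hyF
  have hyC := mem_connectedComponentIn hyF
  obtain ⟨z, hz, hzx⟩ := mem_closure_iff.1 hy.1 _ hF.connectedComponentIn hyC
  have : connectedComponentIn F x = connectedComponentIn F y :=
    (connectedComponentIn_eq hzx).trans (connectedComponentIn_eq hz).symm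
  exact hy.2 (by rw [hF.connectedComponentIn.interior_eq, this]; exact hyC)

theorem Complex.isPreconnected_compl_closedBall (R : ℝ) :
    IsPreconnected (Metric.closedBall (0 : ℂ) R)ᶜ := by
  have : (Metric.closedBall (0 : ℂ) R)ᶜ =
      (fun x : ℝ × ℝ ↦ x.1 * Complex.exp (x.2 * Complex.I)) '' (Ioi R ×ˢ univ) := by
    ext z
    constructor
    · intro hz
      exact ⟨(‖z‖, z.arg), by simpa using hz, Complex.norm_mul_exp_arg_mul_I z⟩
    · rintro ⟨⟨r, t⟩, hr, rfl⟩
      have : R < r := by simpa using hr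
      simpa [Complex.norm_exp_ofReal_mul_I] using this.trans_le (le_abs_self r)
  rw [this]
  exact (isPreconnected_Ioi.prod isPreconnected_univ).image _ (by fun_prop)

/-- The complement of a bounded set in the plane has only one unbounded component. -/
theorem Bornology.IsBounded.connectedComponentIn_compl_eq {K : Set ℂ} (hK : IsBounded K) {p q : ℂ}
    (hp : ¬ IsBounded (connectedComponentIn Kᶜ p))
    (hq : ¬ IsBounded (connectedComponentIn Kᶜ q)) :
    connectedComponentIn Kᶜ p = connectedComponentIn Kᶜ q := by
  obtain ⟨R, hR⟩ := hK.subset_closedBall 0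
  have key : ∀ p, ¬ IsBounded (connectedComponentIn Kᶜ p) →
      (Metric.closedBall (0 : ℂ) R)ᶜ ⊆ connectedComponentIn Kᶜ p := by
    intro p hp
    obtain ⟨x, hx, hxR⟩ : ∃ x ∈ connectedComponentIn Kᶜ p, x ∉ Metric.closedBall (0 : ℂ) R := by
      by_contra! hh
      exact hp (Metric.isBounded_closedBall.subset hh)
    rw [connectedComponentIn_eq hx]
    exact (Complex.isPreconnected_compl_closedBall R).subset_connectedComponentIn hxR
      (compl_subset_compl.2 hR)
  have hx : ((R + 1 : ℝ) : ℂ) ∈ (Metric.closedBall (0 : ℂ) R)ᶜ := by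
    simp only [mem_compl_iff, mem_closedBall_zero_iff, Complex.norm_real, Real.norm_eq_abs, not_le]
    exact (lt_add_one R).trans_le (le_abs_self _)
  exact (connectedComponentIn_eq (key p hp hx)).trans (connectedComponentIn_eq (key q hq hx)).symm

theorem Bornology.IsBounded.exists_not_isBounded_connectedComponentIn {K : Set ℂ}
    (hK : IsBounded K) : ∃ q ∈ Kᶜ, ¬ IsBounded (connectedComponentIn Kᶜ q) := by
  obtain ⟨R, hR⟩ := hK.subset_closedBall 0
  have hx : ∀ r, R < r → (r : ℂ) ∈ (Metric.closedBall (0 : ℂ) R)ᶜ := by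
    intro r hr
    simp only [mem_compl_iff, mem_closedBall_zero_iff, Complex.norm_real, Real.norm_eq_abs, not_le]
    exact hr.trans_le (le_abs_self _)
  have hx1 := hx (R + 1) (lt_add_one R)
  refine ⟨_, compl_subset_compl.2 hR hx1, fun hb ↦ ?_⟩
  obtain ⟨S, hS⟩ := hb.subset_closedBall 0
  have h1 := (Complex.isPreconnected_compl_closedBall R).subset_connectedComponentIn hx1
      (compl_subset_compl.2 hR) (hx _ ((lt_add_one R).trans_le (le_max_left _ (S + 1))))
  have h2 := hS h1
  simp only [mem_closedBall_zero_iff, Complex.norm_real, Real.norm_eq_abs] at h2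
  linarith [le_abs_self (max (R + 1) (S + 1)), le_max_right (R + 1) (S + 1)]

theorem Bornology.IsBounded.isPreconnected_compl {K : Set ℂ} (hK : IsBounded K)
    (h : ∀ p ∈ Kᶜ, ¬ IsBounded (connectedComponentIn Kᶜ p)) : IsPreconnected Kᶜ := by
  refine isPreconnected_of_forall_pair fun p hp q hq ↦
    ⟨connectedComponentIn Kᶜ p, connectedComponentIn_subset _ _, mem_connectedComponentIn hp, ?_,
      isPreconnected_connectedComponentIn⟩
  rw [hK.connectedComponentIn_compl_eq (h p hp) (h q hq)]
  exact mem_connectedComponentIn hq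

/-- An arc does not separate the plane. -/
theorem isPreconnected_compl_image_Icc {c : ℝ → ℂ} {a b : ℝ} (hab : a ≤ b) (hc : Continuous c)
    (hinj : InjOn c (Icc a b)) : IsPreconnected (c '' Icc a b)ᶜ := by
  set K := c '' Icc a b with hK
  have hKc : IsCompact K := isCompact_Icc.image hc
  have hKo : IsOpen Kᶜ := hKc.isClosed.isOpen_compl
  let e : Icc a b → ℂ := fun t ↦ c t
  have hre : range e = K := by rw [hK, image_eq_range]
  have he : IsClosedEmbedding e := Continuous.isClosedEmbedding (by fun_prop) fun s t hst ↦
    Subtype.ext (hinj s.2 t.2 hst)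
  have hunb : ∀ p ∈ Kᶜ, ¬ IsBounded (connectedComponentIn Kᶜ p) := by
    intro p hp hb
    obtain ⟨q, hq, hqb⟩ := hKc.isBounded.exists_not_isBounded_connectedComponentIn
    have hne : ∀ t, c (projIcc a b hab t) - p ≠ 0 := fun t ↦
      sub_ne_zero.2 fun hh ↦ hp ⟨_, (projIcc a b hab t).2, hh⟩
    obtain ⟨g, hg, hge⟩ := Continuous.exists_exp_eq
      (f := fun t : ℝ ↦ c (projIcc a b hab t) - p) (by fun_prop) hne
    refine one_ne_zero (IsClosedEmbedding.exponent_eq_zero he hKo.connectedComponentIn hb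
      (by simpa [hre] using hKo.frontier_connectedComponentIn_subset p)
      (mem_connectedComponentIn hp) (fun hh ↦ hqb ?_) (hre ▸ hq) (m := 1) (n := 0)
      (g := fun t ↦ g t) (by fun_prop) fun t ↦ ?_)
    · rwa [← connectedComponentIn_eq hh]
    · simp [hge, e]
  exact hKc.isBounded.isPreconnected_compl hunb

end Components

section JordanCurve

/-- Any two nonvanishing continuous functions on the circle are multiplicatively dependent up to
functions with a continuous logarithm. -/
theorem Circle.exists_exp_eq_zpow_mul_zpow {f g : Circle → ℂ} (hf : Continuous f)
    (hg : Continuous g) (hf0 : ∀ z, f z ≠ 0) (hg0 : ∀ z, g z ≠ 0) :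
    ∃ m n : ℤ, (m ≠ 0 ∨ n ≠ 0) ∧
      ∃ L : Circle → ℂ, Continuous L ∧ ∀ z, Complex.exp (L z) = f z ^ m * g z ^ n := by
  have key : ∀ f : Circle → ℂ, Continuous f → (∀ z, f z ≠ 0) → ∃ (F : ℝ → ℂ) (k : ℤ),
      Continuous F ∧ (∀ t, Complex.exp (F t) = f (Circle.exp t)) ∧
        ∀ t, F (t + 2 * Real.pi) = F t + k * (2 * Real.pi * Complex.I) := by
    intro f hf hf0
    obtain ⟨F, hF, hFe⟩ := Continuous.exists_exp_eq (f := fun t : ℝ ↦ f (Circle.exp t))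
      (by fun_prop) fun t ↦ hf0 _
    obtain ⟨k, hk⟩ := Complex.exp_eq_exp_iff_exists_int.1
      (show Complex.exp (F (0 + 2 * Real.pi)) = Complex.exp (F 0) by
        rw [hFe, hFe, Circle.exp_add_two_pi])
    refine ⟨F, k, hF, hFe, fun t ↦ ?_⟩
    have := isPreconnected_univ.sub_eq_sub_of_exp_eq (f := fun t ↦ F (t + 2 * Real.pi)) (g := F)
      (by fun_prop) hF.continuousOn (fun t _ ↦ by rw [hFe, hFe, Circle.exp_add_two_pi])
      (mem_univ t) (mem_univ 0)
    linear_combination this + hk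
  obtain ⟨F, k, hF, hFe, hFk⟩ := key f hf hf0
  obtain ⟨G, l, hG, hGe, hGl⟩ := key g hg hg0
  obtain ⟨m, n, hmn, hkl⟩ : ∃ m n : ℤ, (m ≠ 0 ∨ n ≠ 0) ∧ m * k + n * l = 0 := by
    by_cases hk : k = 0
    · exact ⟨1, 0, by simp, by simp [hk]⟩
    · exact ⟨l, -k, .inr (neg_ne_zero.2 hk), by ring⟩
  have hkl' : (m * k + n * l : ℂ) = 0 := by exact_mod_cast hkl
  have hper : Function.Periodic (fun t ↦ m * F t + n * G t) (2 * Real.pi) := fun t ↦ by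
    simp only [hFk, hGl]
    linear_combination (2 * Real.pi * Complex.I) * hkl'
  have hL : ∀ t : ℝ, (fun t ↦ m * F t + n * G t) (Complex.arg (Circle.exp t)) =
      m * F t + n * G t := by
    intro t
    obtain ⟨j, hj⟩ := Circle.exp_eq_exp.1 (Circle.exp_arg (Circle.exp t))
    rw [hj]
    exact hper.int_mul j t
  refine ⟨m, n, hmn, fun z ↦ (fun t ↦ m * F t + n * G t) (Complex.arg z), ?_, fun z ↦ ?_⟩
  · rw [Circle.isAddQuotientCoveringMap_exp.toIsQuotientMap.continuous_iff]
    exact (by fun_prop : Continuous fun t ↦ m * F t + n * G t).congr fun t ↦ (hL t).symm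
  · simp only [Complex.exp_add, Complex.exp_int_mul, hFe, hGe, Circle.exp_arg]

variable {γ : Circle → ℂ}

/-- The complement of a Jordan curve has at most one bounded component. -/
theorem mem_connectedComponentIn_compl_range_of_isBounded (hcont : Continuous γ)
    (hinj : Function.Injective γ) {p q : ℂ} (hp : p ∈ (range γ)ᶜ) (hq : q ∈ (range γ)ᶜ)
    (hpb : IsBounded (connectedComponentIn (range γ)ᶜ p))
    (hqb : IsBounded (connectedComponentIn (range γ)ᶜ q)) :
    q ∈ connectedComponentIn (range γ)ᶜ p := by
  by_contra hqp
  have hKo : IsOpen (range γ)ᶜ := (isCompact_range hcont).isClosed.isOpen_compl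
  have he : IsClosedEmbedding γ := hcont.isClosedEmbedding hinj
  have hpq : p ∉ connectedComponentIn (range γ)ᶜ q := fun hh ↦
    hqp (connectedComponentIn_eq hh ▸ mem_connectedComponentIn hq)
  have hfr : ∀ p, frontier (connectedComponentIn (range γ)ᶜ p) ⊆ range γ := fun p ↦ by
    simpa using hKo.frontier_connectedComponentIn_subset p
  obtain ⟨m, n, hmn, L, hL, hLe⟩ := Circle.exists_exp_eq_zpow_mul_zpow
    (f := fun z ↦ γ z - p) (g := fun z ↦ γ z - q) (by fun_prop) (by fun_prop)
    (fun z ↦ sub_ne_zero.2 fun hh ↦ hp ⟨z, hh⟩) (fun z ↦ sub_ne_zero.2 fun hh ↦ hq ⟨z, hh⟩)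
  rcases hmn with hm | hn
  · exact hm (he.exponent_eq_zero hKo.connectedComponentIn hpb (hfr p)
      (mem_connectedComponentIn hp) hqp hq hL hLe)
  · exact hn (he.exponent_eq_zero hKo.connectedComponentIn hqb (hfr q)
      (mem_connectedComponentIn hq) hpq hp hL fun x ↦ (hLe x).trans (mul_comm _ _))

/-- There is no continuous branch of `log ((z - b) / (z - a))` on the plane without `a` and `b`. -/
theorem not_exists_exp_eq_div_compl_pair {a b : ℂ} (hab : a ≠ b) {L : ℂ → ℂ}
    (hL : ContinuousOn L {a, b}ᶜ)
    (hLe : ∀ z ∈ ({a, b} : Set ℂ)ᶜ, Complex.exp (L z) = (z - b) / (z - a)) : False := by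
  have hd : 0 < ‖a - b‖ := norm_pos_iff.2 (sub_ne_zero.2 hab)
  have hab' : a - b ≠ 0 := sub_ne_zero.2 hab
  set r : ℝ := ‖a - b‖ / 2 with hr
  have hr0 : (r : ℂ) ≠ 0 := by exact_mod_cast (half_pos hd).ne'
  have hrn : ∀ t : ℝ, ‖r * Complex.exp (t * Complex.I)‖ = r := fun t ↦ by
    rw [norm_mul, Complex.norm_exp_ofReal_mul_I, Complex.norm_real, mul_one, Real.norm_eq_abs,
      abs_of_pos (half_pos hd)]
  have hmem : ∀ t : ℝ, a + r * Complex.exp (t * Complex.I) ∈ ({a, b} : Set ℂ)ᶜ := by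
    rintro t (h | h)
    · simp [hr0] at h
    · have h1 := hrn t
      rw [eq_sub_of_add_eq' (mem_singleton_iff.1 h), norm_sub_rev] at h1
      linarith
  have hslit : ∀ t : ℝ, 1 + r * Complex.exp (t * Complex.I) / (a - b) ∈ Complex.slitPlane := by
    intro t
    refine Complex.mem_slitPlane_of_norm_lt_one ?_
    rw [norm_div, hrn, hr, div_div, div_lt_one (by positivity)]
    linarith
  refine absurd (eq_zero_of_exp_eq_circle (m := -1) (c := (a - b) / r)
    (u := fun t : ℝ ↦ L (a + r * Complex.exp (t * Complex.I)) -
      Complex.log (1 + r * Complex.exp (t * Complex.I) / (a - b))) ?_ (fun t ↦ ?_) ?_) (by simp)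
  · exact (hL.comp_continuous (by fun_prop) hmem).sub (Continuous.clog (by fun_prop) hslit)
  · rw [Complex.exp_sub, hLe _ (hmem t), Complex.exp_log (Complex.slitPlane_ne_zero (hslit t))]
    have h1 := Complex.slitPlane_ne_zero (hslit t)
    have h2 : a - b + r * Complex.exp (t * Complex.I) ≠ 0 := by
      have := mul_ne_zero hab' h1
      rwa [mul_add, mul_one, mul_div_cancel₀ _ hab'] at this
    have h3 := Complex.exp_ne_zero (t * Complex.I)
    rw [show ((-1 : ℤ) : ℂ) * (t * Complex.I) = -(t * Complex.I) by simp, Complex.exp_neg,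
      add_sub_cancel_left,
      show 1 + r * Complex.exp (t * Complex.I) / (a - b) =
        (a - b + r * Complex.exp (t * Complex.I)) / (a - b) by field_simp,
      show a + r * Complex.exp (t * Complex.I) - b = a - b + r * Complex.exp (t * Complex.I) by
        ring]
    field_simp
  · simp

/-- If two paths from `a` to `b` meet only in their endpoints, then they separate the plane. -/
theorem not_isConnected_compl_union_range {c₁ c₂ : C(unitInterval, ℂ)} (h0 : c₁ 0 = c₂ 0)
    (h1 : c₁ 1 = c₂ 1) (hne : c₁ 0 ≠ c₁ 1) (hinter : range c₁ ∩ range c₂ ⊆ {c₁ 0, c₁ 1}) :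
    ¬ IsConnected (range c₁ ∪ range c₂)ᶜ := by
  classical
  rintro ⟨⟨z₀, hz₀⟩, hconn⟩
  obtain ⟨L₁, hL₁, hL₁e⟩ := exists_exp_eq_div_compl_range c₁
  obtain ⟨L₂, hL₂, hL₂e⟩ := exists_exp_eq_div_compl_range c₂
  have hs₁ : (range c₁ ∪ range c₂)ᶜ ⊆ (range c₁)ᶜ := compl_subset_compl.2 subset_union_left
  have hs₂ : (range c₁ ∪ range c₂)ᶜ ⊆ (range c₂)ᶜ := compl_subset_compl.2 subset_union_right
  have ho₁ : IsOpen (range c₁)ᶜ := (isCompact_range c₁.continuous).isClosed.isOpen_compl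
  have ho₂ : IsOpen (range c₂)ᶜ := (isCompact_range c₂.continuous).isClosed.isOpen_compl
  have heq : ∀ z ∈ (range c₁ ∪ range c₂)ᶜ, Complex.exp (L₁ z) = Complex.exp (L₂ z) :=
    fun z hz ↦ by rw [hL₁e z (hs₁ hz), hL₂e z (hs₂ hz), h0, h1]
  have hd : ∀ z ∈ (range c₁ ∪ range c₂)ᶜ, L₁ z = L₂ z + (L₁ z₀ - L₂ z₀) := fun z hz ↦
    sub_eq_iff_eq_add'.1 (hconn.sub_eq_sub_of_exp_eq (hL₁.mono hs₁) (hL₂.mono hs₂) heq hz hz₀)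
  have hde : Complex.exp (L₁ z₀ - L₂ z₀) = 1 := by
    rw [Complex.exp_sub, heq z₀ hz₀, div_self (Complex.exp_ne_zero _)]
  let L : ℂ → ℂ := fun z ↦ if z ∈ range c₁ then L₂ z + (L₁ z₀ - L₂ z₀) else L₁ z
  have hLL₁ : ∀ z ∈ (range c₁)ᶜ, L z = L₁ z := fun z hz ↦ if_neg hz
  have hLL₂ : ∀ z ∈ (range c₂)ᶜ, L z = L₂ z + (L₁ z₀ - L₂ z₀) := by
    intro z hz
    by_cases hz1 : z ∈ range c₁
    · exact if_pos hz1
    · rw [hLL₁ z hz1]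
      exact hd z fun hh ↦ hh.elim hz1 hz
  have hcases : ∀ z ∈ ({c₁ 0, c₁ 1} : Set ℂ)ᶜ, z ∈ (range c₁)ᶜ ∨ z ∈ (range c₂)ᶜ := by
    intro z hz
    by_contra! hh
    exact hz (hinter ⟨not_not.1 hh.1, not_not.1 hh.2⟩)
  refine not_exists_exp_eq_div_compl_pair hne (L := L) (fun z hz ↦ ?_) fun z hz ↦ ?_
  · refine ContinuousAt.continuousWithinAt ?_
    rcases hcases z hz with h | h
    · exact (hL₁.continuousAt (ho₁.mem_nhds h)).congr
        (Filter.eventuallyEq_of_mem (ho₁.mem_nhds h) fun w hw ↦ (hLL₁ w hw).symm)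
    · exact ((hL₂.continuousAt (ho₂.mem_nhds h)).add continuousAt_const).congr
        (Filter.eventuallyEq_of_mem (ho₂.mem_nhds h) fun w hw ↦ (hLL₂ w hw).symm)
  · rcases hcases z hz with h | h
    · rw [hLL₁ z h, hL₁e z h]
    · rw [hLL₂ z h, Complex.exp_add, hde, mul_one, hL₂e z h, h0, h1]

theorem not_isConnected_compl_range (hcont : Continuous γ) (hinj : Function.Injective γ) :
    ¬ IsConnected (range γ)ᶜ := by
  have hpi := Real.pi_pos
  let c₁ : C(unitInterval, ℂ) := ⟨fun t ↦ γ (Circle.exp (Real.pi * t)), by fun_prop⟩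
  let c₂ : C(unitInterval, ℂ) := ⟨fun t ↦ γ (Circle.exp (-(Real.pi * t))), by fun_prop⟩
  have hunion : range c₁ ∪ range c₂ = range γ := by
    refine Subset.antisymm (union_subset ?_ ?_) ?_
    · rintro _ ⟨t, rfl⟩
      exact ⟨_, rfl⟩
    · rintro _ ⟨t, rfl⟩
      exact ⟨_, rfl⟩
    · rintro _ ⟨z, rfl⟩
      have h1 := Complex.neg_pi_lt_arg z
      have h2 := Complex.arg_le_pi z
      rcases le_total 0 (Complex.arg z) with h | h
      · refine .inl ⟨⟨Complex.arg z / Real.pi, by positivity, (div_le_one hpi).2 h2⟩, ?_⟩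
        simp [c₁, mul_div_cancel₀ _ hpi.ne', Circle.exp_arg]
      · refine .inr ⟨⟨-Complex.arg z / Real.pi, div_nonneg (by linarith) hpi.le,
          (div_le_one hpi).2 (by linarith)⟩, ?_⟩
        simp [c₂, mul_div_cancel₀ _ hpi.ne', Circle.exp_arg]
  have hmod : ∀ s t : unitInterval, Circle.exp (Real.pi * s) = Circle.exp (-(Real.pi * t)) →
      s = 0 ∨ s = 1 := by
    intro s t hst
    obtain ⟨m, hm⟩ := Circle.exp_eq_exp.1 hst
    have hm' : (s + t : ℝ) = 2 * m := by
      refine mul_left_cancel₀ hpi.ne' ?_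
      linear_combination hm
    have hs := s.2
    have ht := t.2
    have hm0 : (-1 : ℝ) < m := by linarith [hs.1, ht.1]
    have hm1 : (m : ℝ) < 2 := by linarith [hs.2, ht.2]
    have hm0' : -1 < m := by exact_mod_cast hm0
    have hm1' : m < 2 := by exact_mod_cast hm1
    obtain rfl | rfl : m = 0 ∨ m = 1 := by lia
    · exact .inl (Subtype.ext (by push_cast at *; linarith [hs.1, ht.1]))
    · exact .inr (Subtype.ext (by push_cast at *; linarith [hs.2, ht.2]))
  rw [← hunion]
  refine not_isConnected_compl_union_range (by simp [c₁, c₂]) ?_ ?_ ?_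
  · exact congrArg γ (Circle.exp_eq_exp.2 ⟨1, by simp; ring⟩)
  · intro h
    have := hinj h
    simp [Circle.ext_iff] at this
    norm_num at this
  · rintro _ ⟨⟨s, rfl⟩, t, ht⟩
    rcases hmod s t (hinj ht.symm) with rfl | rfl <;> simp

/-- An open set whose frontier lies on a Jordan curve, and which meets but does not contain the
complement of the curve, has the whole curve as its frontier. -/
theorem frontier_eq_range_of_subset (hcont : Continuous γ) (hinj : Function.Injective γ)
    {V : Set ℂ} (hVo : IsOpen V) (hfr : frontier V ⊆ range γ) (hV : ((range γ)ᶜ ∩ V).Nonempty)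
    (hV' : ((range γ)ᶜ \ V).Nonempty) : frontier V = range γ := by
  have hpi := Real.pi_pos
  refine hfr.antisymm ?_
  rintro _ ⟨z, rfl⟩
  by_contra hz
  obtain ⟨θ, rfl⟩ := Circle.exp_surjective z
  have hc : Continuous fun t : ℝ ↦ γ (Circle.exp t) := by fun_prop
  obtain ⟨δ, hδ, hball⟩ := Metric.isOpen_iff.1
    (isClosed_frontier.isOpen_compl.preimage hc) θ hz
  obtain ⟨ε, hε, hεδ, hεπ⟩ : ∃ ε > 0, ε < δ ∧ ε < Real.pi :=
    ⟨min δ Real.pi / 2, by positivity, by linarith [min_le_left δ Real.pi, lt_min hδ hpi],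
      by linarith [min_le_right δ Real.pi, lt_min hδ hpi]⟩
  set A := (fun t : ℝ ↦ γ (Circle.exp t)) '' Icc (θ + ε) (θ - ε + 2 * Real.pi)
  have hAγ : A ⊆ range γ := by
    rintro _ ⟨t, -, rfl⟩
    exact ⟨_, rfl⟩
  have hfrA : frontier V ⊆ A := by
    intro y hy
    obtain ⟨w, rfl⟩ := hfr hy
    obtain ⟨s, hs, rfl⟩ : ∃ s ∈ Ico (θ - ε) (θ - ε + 2 * Real.pi), Circle.exp s = w := by
      obtain ⟨s, rfl⟩ := Circle.exp_surjective w
      obtain ⟨s', hs', h⟩ := Circle.periodic_exp.exists_mem_Ico Real.two_pi_pos s (θ - ε)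
      exact ⟨s', hs', h.symm⟩
    refine ⟨s, ⟨?_, hs.2.le⟩, rfl⟩
    by_contra! hlt
    refine hball (a := s) ?_ hy
    rw [Metric.mem_ball, Real.dist_eq, abs_lt]
    constructor <;> linarith [hs.1]
  have hconn : IsPreconnected Aᶜ := isPreconnected_compl_image_Icc (by linarith) hc
    (hinj.comp_injOn (Circle.exp_injOn_Icc (by linarith)))
  have hVA : Aᶜ ⊆ V ∪ (closure V)ᶜ := by
    intro y hyA
    by_contra! hy
    rw [mem_union, not_or, mem_compl_iff, not_not, closure_eq_self_union_frontier] at hy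
    exact hy.2.elim hy.1 fun h ↦ hyA (hfrA h)
  obtain ⟨x, hx, hxV⟩ := hV
  obtain ⟨y, hy, hyV⟩ := hV'
  obtain ⟨w, -, hwV, hw⟩ := hconn V (closure V)ᶜ hVo isClosed_closure.isOpen_compl hVA
    ⟨x, fun h ↦ hx (hAγ h), hxV⟩
    ⟨y, fun h ↦ hy (hAγ h), by
      rw [mem_compl_iff, closure_eq_self_union_frontier]
      exact fun h ↦ h.elim hyV fun h' ↦ hy (hfr h')⟩
  exact hw (subset_closure hwV)

end JordanCurve

/-- The Jordan curve theorem, together with the identification of the trace as the common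
boundary: the complement of the trace `K` of a Jordan curve has exactly two connected
components, a bounded interior `I` and an unbounded exterior `E`, and
`K = frontier I = frontier E`. -/
theorem jordan_curve_theorem (γ : Circle → ℂ) (hcont : Continuous γ)
    (hinj : Function.Injective γ) :
    ∃ I E : Set ℂ, IsConnected I ∧ IsConnected E ∧
      IsBounded I ∧ ¬ IsBounded E ∧ Disjoint I E ∧ I ∪ E = (Set.range γ)ᶜ ∧
      (∀ C : Set ℂ, IsConnected C → C ⊆ (Set.range γ)ᶜ → C ⊆ I ∨ C ⊆ E) ∧
      frontier I = Set.range γ ∧ frontier E = Set.range γ := by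
  have hK : IsBounded (range γ) := (isCompact_range hcont).isBounded
  have hKo : IsOpen (range γ)ᶜ := (isCompact_range hcont).isClosed.isOpen_compl
  obtain ⟨q, hq, hqb⟩ := hK.exists_not_isBounded_connectedComponentIn
  obtain ⟨p, hp, hpb⟩ : ∃ p ∈ (range γ)ᶜ, IsBounded (connectedComponentIn (range γ)ᶜ p) := by
    by_contra! hh
    exact not_isConnected_compl_range hcont hinj ⟨⟨q, hq⟩, hK.isPreconnected_compl hh⟩
  have hdisj : Disjoint (connectedComponentIn (range γ)ᶜ p) (connectedComponentIn (range γ)ᶜ q) :=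
    disjoint_left.2 fun x hxp hxq ↦ hqb
      (((connectedComponentIn_eq hxp).trans (connectedComponentIn_eq hxq).symm) ▸ hpb)
  have hcover : ∀ x ∈ (range γ)ᶜ, x ∈ connectedComponentIn (range γ)ᶜ p ∨
      x ∈ connectedComponentIn (range γ)ᶜ q := by
    intro x hx
    by_cases hxb : IsBounded (connectedComponentIn (range γ)ᶜ x)
    · exact .inl (mem_connectedComponentIn_compl_range_of_isBounded hcont hinj hp hx hpb hxb)
    · exact .inr (hK.connectedComponentIn_compl_eq hxb hqb ▸ mem_connectedComponentIn hx)
  have hfr : ∀ p, frontier (connectedComponentIn (range γ)ᶜ p) ⊆ range γ := fun p ↦ by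
    simpa using hKo.frontier_connectedComponentIn_subset p
  have hpp := mem_connectedComponentIn hp
  have hqq := mem_connectedComponentIn hq
  refine ⟨_, _, isConnected_connectedComponentIn_iff.2 hp,
    isConnected_connectedComponentIn_iff.2 hq, hpb, hqb, hdisj,
    (union_subset (connectedComponentIn_subset _ _) (connectedComponentIn_subset _ _)).antisymm
      hcover, fun C hC hCK ↦ ?_,
    frontier_eq_range_of_subset hcont hinj hKo.connectedComponentIn (hfr p) ⟨p, hp, hpp⟩
      ⟨q, hq, disjoint_right.1 hdisj hqq⟩,
    frontier_eq_range_of_subset hcont hinj hKo.connectedComponentIn (hfr q) ⟨q, hq, hqq⟩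
      ⟨p, hp, disjoint_left.1 hdisj hpp⟩⟩
  obtain ⟨x, hx⟩ := hC.nonempty
  have hCx := hC.isPreconnected.subset_connectedComponentIn hx hCK
  refine (hcover x (hCK hx)).imp (fun h ↦ ?_) fun h ↦ ?_
  · rwa [connectedComponentIn_eq h]
  · rwa [connectedComponentIn_eq h]
end

section
/- There exists a fundamental set F for Γ = PSL₂(ℤ) acting on ℍ that is not Lebesgue measurable and satisfies F ⊆ closure(interior(F)). -/
open MeasureTheory

/-- The Möbius action of `SL₂(ℤ)` (factoring through `PSL₂(ℤ)`) on points of `ℂ`. -/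
noncomputable def mobius (g : Matrix.SpecialLinearGroup (Fin 2) ℤ) (z : ℂ) : ℂ :=
  (((g 0 0 : ℤ) : ℂ) * z + ((g 0 1 : ℤ) : ℂ)) / (((g 1 0 : ℤ) : ℂ) * z + ((g 1 1 : ℤ) : ℂ))

open Set Topology Filter
open scoped MatrixGroups Modular UpperHalfPlane

lemma coe_smul_eq_mobius (g : SL(2, ℤ)) (z : ℍ) : ((g • z : ℍ) : ℂ) = mobius g z := by
  rw [UpperHalfPlane.coe_specialLinearGroup_apply]
  simp [mobius]

/-- The image of a section of the orbit map meets each orbit exactly once. -/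
lemma existsUnique_mobius_of_section (s : MulAction.orbitRel.Quotient SL(2, ℤ) ℍ → ℍ)
    (hs : ∀ q, (Quotient.mk'' (s q) : MulAction.orbitRel.Quotient SL(2, ℤ) ℍ) = q)
    (z : ℂ) (hz : 0 < z.im) :
    ∃! w : ℂ, w ∈ (↑) '' range s ∧ ∃ g : SL(2, ℤ), mobius g z = w := by
  lift z to ℍ using hz
  refine ⟨s (Quotient.mk'' z), ⟨⟨_, mem_range_self _, rfl⟩, ?_⟩, ?_⟩
  · obtain ⟨g, hg⟩ := MulAction.orbitRel_apply.mp (Quotient.exact (hs (Quotient.mk'' z)))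
    exact ⟨g, by rw [← coe_smul_eq_mobius, ← hg]⟩
  · rintro _ ⟨⟨_, ⟨q, rfl⟩, rfl⟩, g, hg⟩
    rw [← coe_smul_eq_mobius, UpperHalfPlane.coe_inj] at hg
    have : q = Quotient.mk'' z := by
      rw [← hs q, ← hg]
      exact Quotient.sound (MulAction.orbitRel_apply.mpr ⟨g, rfl⟩)
    rw [this]

/-- Translating a part `E` of the open fundamental domain by `1` turns a suitable fundamental set
into another one. -/
lemma exists_fundamental_set_translate (E : Set ℂ) (hE : E ⊆ (↑) '' 𝒟ᵒ) :
    ∃ R : Set ℂ, (↑) '' 𝒟ᵒ ⊆ R ∧ R ⊆ closure ((↑) '' 𝒟ᵒ) ∧ R ⊆ {z | 0 < z.im} ∧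
      ∀ z : ℂ, 0 < z.im → ∃! w : ℂ, w ∈ R \ E ∪ (· + 1) '' E ∧
        ∃ g : SL(2, ℤ), mobius g z = w := by
  classical
  have key : ∀ q : MulAction.orbitRel.Quotient SL(2, ℤ) ℍ, ∃ z ∈ 𝒟, Quotient.mk'' z = q := by
    intro q
    induction q using Quotient.inductionOn' with | h z =>
    obtain ⟨g, hg⟩ := ModularGroup.exists_smul_mem_fd z
    exact ⟨_, hg, Quotient.sound (MulAction.orbitRel_apply.mpr ⟨g, rfl⟩)⟩
  choose s hsfd hs using key
  let τ : ℍ → ℍ := fun z ↦ if (z : ℂ) ∈ E then ModularGroup.T • z else z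
  have hτ : ∀ q, (Quotient.mk'' (τ (s q)) : MulAction.orbitRel.Quotient SL(2, ℤ) ℍ) = q := by
    intro q
    by_cases h : (s q : ℂ) ∈ E
    · simp only [τ, if_pos h]
      conv_rhs => rw [← hs q]
      exact Quotient.sound (MulAction.orbitRel_apply.mpr ⟨_, rfl⟩)
    · simp only [τ, if_neg h, hs]
  have hT : ∀ z : ℍ, ((ModularGroup.T • z : ℍ) : ℂ) = z + 1 := fun z ↦ by
    simpa using ModularGroup.coe_T_zpow_smul_eq (z := z) (n := 1)
  have hsub : ((↑) : ℍ → ℂ) '' 𝒟ᵒ ⊆ (↑) '' range s := by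
    rintro _ ⟨z, hz, rfl⟩
    refine ⟨z, ⟨Quotient.mk'' z, ?_⟩, rfl⟩
    obtain ⟨g, hg⟩ := MulAction.orbitRel_apply.mp (Quotient.exact (hs (Quotient.mk'' z)))
    have h := hsfd (Quotient.mk'' z)
    rw [← hg] at h ⊢
    rcases ModularGroup.eq_one_or_neg_one_of_mem_fdo_mem_fd hz h with rfl | rfl <;> simp
  refine ⟨(↑) '' range s, hsub, ?_, ?_, ?_⟩
  · rintro _ ⟨_, ⟨q, rfl⟩, rfl⟩
    have := hsfd q
    rw [ModularGroup.fd_eq_closure_fdo] at this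
    exact image_closure_subset_closure_image UpperHalfPlane.continuous_coe ⟨_, this, rfl⟩
  · rintro _ ⟨z, -, rfl⟩
    exact z.im_pos
  · have : ((↑) : ℍ → ℂ) '' range s \ E ∪ (· + 1) '' E = (↑) '' range (τ ∘ s) := by
      ext w
      constructor
      · rintro (⟨⟨_, ⟨q, rfl⟩, rfl⟩, hw⟩ | ⟨w, hw, rfl⟩)
        · exact ⟨_, ⟨q, rfl⟩, by simp [τ, hw]⟩
        · obtain ⟨_, ⟨q, rfl⟩, rfl⟩ := hsub (hE hw)
          exact ⟨_, ⟨q, rfl⟩, by simp only [← hT, τ, Function.comp_apply, if_pos hw]⟩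
      · rintro ⟨_, ⟨q, rfl⟩, rfl⟩
        by_cases h : (s q : ℂ) ∈ E
        · exact Or.inr ⟨_, h, by simp only [← hT, τ, Function.comp_apply, if_pos h]⟩
        · exact Or.inl ⟨⟨_, ⟨q, rfl⟩, by simp [τ, h]⟩, by simp [τ, h]⟩
    rw [this]
    exact existsUnique_mobius_of_section _ hτ

/-- **Vitali**: every set of positive measure in `ℂ` has a nonmeasurable subset. -/
lemma exists_subset_not_nullMeasurableSet (K : Set ℂ) (hK : volume K ≠ 0) :
    ∃ A ⊆ K, ¬ NullMeasurableSet A volume := by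
  by_contra! H
  let G : AddSubgroup ℂ := (Rat.castHom ℂ).toAddMonoidHom.range
  have : Countable G := (countable_range (Rat.castHom ℂ)).to_subtype
  obtain ⟨A, hAK, hA⟩ := exists_subset_bijOn K (QuotientAddGroup.mk : ℂ → ℂ ⧸ G)
  obtain ⟨t, htA, ht, hte⟩ := (H A hAK).exists_measurable_subset_ae_eq
  have hA0 : volume A = 0 := by
    rw [← measure_congr hte]
    by_contra h0
    have hnhds := Measure.sub_mem_nhds_zero_of_addHaar_pos volume t ht (pos_iff_ne_zero.mpr h0)
    obtain ⟨n, x, hx, y, hy, hxy⟩ :=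
      ((tendsto_one_div_add_atTop_nhds_zero_nat (𝕜 := ℂ)).eventually hnhds).exists
    have hxy' : x = y := by
      refine hA.injOn (htA hx) (htA hy) (QuotientAddGroup.eq.mpr ⟨-(1 / (n + 1)), ?_⟩)
      simp only [RingHom.toAddMonoidHom_eq_coe, AddMonoidHom.coe_coe, Rat.coe_castHom]
      push_cast
      rw [← hxy]
      ring
    have h1 : (1 : ℂ) / (n + 1) = 0 := by rw [← hxy, hxy']; exact sub_self y
    exact one_div_ne_zero (Nat.cast_add_one_ne_zero n) h1
  refine hK (measure_mono_null (t := ⋃ g : G, (· + (g : ℂ)) ⁻¹' A) ?_ ?_)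
  · intro z hz
    obtain ⟨a, ha, haz⟩ := hA.surjOn (mem_image_of_mem _ hz)
    refine mem_iUnion.mpr ⟨⟨-z + a, QuotientAddGroup.eq.mp haz.symm⟩, ?_⟩
    simpa using ha
  · rw [measure_iUnion_null_iff]
    intro g
    rw [measure_preimage_add_right, hA0]

/-- Every ball in `ℂ` contains a set of positive measure that lies in the closures of two disjoint
open sets, one of them inside the ball. -/
lemma exists_isOpen_pos_measure_frontier {c : ℂ} {r : ℝ} (hr : 0 < r) :
    ∃ U V K : Set ℂ, IsOpen U ∧ IsOpen V ∧ Disjoint U V ∧ V ⊆ Metric.ball c r ∧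
      MeasurableSet K ∧ volume K ≠ 0 ∧ K ⊆ closure U ∧ K ⊆ closure V := by
  obtain ⟨S, hSc, hSd⟩ := TopologicalSpace.exists_countable_dense ℂ
  have hb : volume (Metric.ball c r) ≠ 0 := (Metric.measure_ball_pos _ _ hr).ne'
  obtain ⟨W, hSW, hW, hWm⟩ := S.exists_isOpen_lt_of_lt (μ := volume) (volume (Metric.ball c r))
    (by rw [hSc.measure_zero]; exact hb.bot_lt)
  have hWd : Dense W := hSd.mono hSW
  let d : ℂ → ℝ := fun z ↦ Metric.infDist z Wᶜ
  have hdc : Continuous d := Metric.continuous_infDist_pt _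
  let f : ℝ → Set ℂ := fun σ ↦ {z | 0 < d z} ∩ {z | 0 < σ * Real.sin (d z)⁻¹}
  have hf : ∀ σ, IsOpen (f σ) := fun σ ↦
    ContinuousOn.isOpen_inter_preimage (f := fun z ↦ σ * Real.sin (d z)⁻¹)
      (continuousOn_const.mul (Real.continuous_sin.comp_continuousOn
        (hdc.continuousOn.inv₀ fun z (hz : 0 < d z) ↦ hz.ne')))
      (isOpen_lt continuous_const hdc) isOpen_Ioi
  have key : ∀ (σ x : ℝ), 0 < σ * Real.sin x → ∀ z ∈ Wᶜ, z ∈ closure (f σ) := by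
    intro σ x hx z hz
    rw [Metric.mem_closure_iff]
    intro ε hε
    obtain ⟨w, hwz, hw⟩ := hWd.exists_mem_open Metric.isOpen_ball ⟨z, Metric.mem_ball_self hε⟩
    have hdw : 0 < d w := (hW.isClosed_compl.notMem_iff_infDist_pos ⟨z, hz⟩).mp (by simpa using hwz)
    have hdz : d z = 0 := Metric.infDist_zero_of_mem hz
    obtain ⟨n, hn⟩ := exists_nat_gt (((d w)⁻¹ - x) / (2 * Real.pi))
    obtain ⟨n, hn⟩ : ∃ n : ℕ, (d w)⁻¹ < x + n * (2 * Real.pi) := by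
      rw [div_lt_iff₀ (by positivity)] at hn
      exact ⟨n, by linarith⟩
    have hpos : 0 < x + n * (2 * Real.pi) := (inv_pos.mpr hdw).trans hn
    obtain ⟨y, hy, hdy⟩ := Metric.isPreconnected_ball.intermediate_value
      (Metric.mem_ball_self hε) hw hdc.continuousOn
      (show (x + n * (2 * Real.pi))⁻¹ ∈ Icc (d z) (d w) from
        ⟨hdz ▸ (inv_pos.mpr hpos).le, (inv_lt_of_inv_lt₀ hdw hn).le⟩)
    refine ⟨y, ⟨?_, ?_⟩, Metric.mem_ball'.mp hy⟩
    · simpa [hdy] using hpos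
    · simpa [hdy] using hx
  refine ⟨f (-1), f 1 ∩ Metric.ball c r, Metric.ball c r \ W, hf _, (hf _).inter Metric.isOpen_ball,
    ?_, inter_subset_right, Metric.isOpen_ball.measurableSet.diff hW.measurableSet, ?_, ?_, ?_⟩
  · rw [disjoint_left]
    rintro z ⟨-, h1⟩ ⟨⟨-, h2⟩, -⟩
    simp only [mem_ofPred_eq] at h1 h2
    linarith
  · exact (tsub_pos_of_lt hWm |>.trans_le le_measure_sdiff).ne'
  · exact fun z hz ↦ key (-1) (-(Real.pi / 2)) (by simp) z hz.2
  · intro z hz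
    have := key 1 (Real.pi / 2) (by simp) z hz.2
    exact inter_comm (f 1) _ ▸ Metric.isOpen_ball.inter_closure ⟨hz.1, this⟩

/-- Example 5: there is a fundamental set `F ⊆ ℍ` for `PSL₂(ℤ)` that is not Lebesgue
measurable and satisfies `F ⊆ closure (interior F)`. -/
theorem exists_nonmeasurable_fundamental_set :
    ∃ F : Set ℂ, F ⊆ {z : ℂ | 0 < z.im} ∧
      (∀ z : ℂ, 0 < z.im → ∃! w : ℂ, w ∈ F ∧
        ∃ g : Matrix.SpecialLinearGroup (Fin 2) ℤ, mobius g z = w) ∧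
      ¬ NullMeasurableSet F volume ∧
      F ⊆ closure (interior F) := by
  set D : Set ℂ := (↑) '' 𝒟ᵒ with hD
  have hDc := ModularGroup.coe_fdo
  rw [← hD] at hDc
  have hDo : IsOpen D := UpperHalfPlane.isOpenEmbedding_coe.isOpenMap _ ModularGroup.isOpen_fdo
  have hDne : (2 * Complex.I) ∈ D := by
    rw [hDc]; norm_num
  obtain ⟨r, hr, hrD⟩ := Metric.nhds_basis_closedBall.mem_iff.mp (hDo.mem_nhds hDne)
  obtain ⟨U, V₀, K, hU, hV₀, hUV₀, hV₀r, hKm, hK0, hKU, hKV₀⟩ :=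
    exists_isOpen_pos_measure_frontier (c := 2 * Complex.I) hr
  let V := interior (closure V₀)
  have hV₀V : V₀ ⊆ V := hV₀.subset_interior_closure
  have hVcl : closure V ⊆ D := (closure_minimal interior_subset isClosed_closure).trans
    ((closure_minimal (hV₀r.trans Metric.ball_subset_closedBall) Metric.isClosed_closedBall).trans
      hrD)
  have hKV : Disjoint K V := by
    have h1 : Disjoint U V := (hUV₀.closure_right hU).mono_right interior_subset
    exact (h1.closure_left isOpen_interior).mono_left hKU
  have hKcl : K ⊆ closure V := hKV₀.trans (closure_mono hV₀V)
  obtain ⟨A, hAK, hA⟩ := exists_subset_not_nullMeasurableSet K hK0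
  have hEcl : A ∪ V ⊆ closure V := union_subset (hAK.trans hKcl) subset_closure
  have hED := hEcl.trans hVcl
  obtain ⟨R, hDR, hRD, hRim, hR⟩ := exists_fundamental_set_translate (A ∪ V) hED
  refine ⟨R \ (A ∪ V) ∪ (· + 1) '' (A ∪ V), ?_, hR, ?_, ?_⟩
  · refine union_subset (sdiff_subset.trans hRim) ?_
    rintro _ ⟨z, hz, rfl⟩
    have := hRim (hDR (hED hz))
    simpa using this
  · intro hF
    refine hA ?_
    have : A = K \ ((R \ (A ∪ V) ∪ (· + 1) '' (A ∪ V)) ∩ K) := by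
      ext z
      constructor
      · refine fun hz ↦ ⟨hAK hz, ?_⟩
        rintro ⟨⟨-, h⟩ | ⟨w, hw, rfl⟩, -⟩
        · exact h (Or.inl hz)
        · have h1 := hED hw
          have h2 := hVcl (hKcl (hAK hz))
          rw [hDc] at h1 h2
          have h3 := (abs_lt.mp h1.2.2).1
          have h4 := (abs_lt.mp h2.2.2).2
          simp only [Complex.add_re, Complex.one_re] at h4
          linarith
      · rintro ⟨hz, hn⟩
        by_contra hzA
        exact hn ⟨Or.inl ⟨hDR (hVcl (hKcl hz)),
          fun h ↦ h.elim hzA (disjoint_left.mp hKV hz)⟩, hz⟩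
    rw [this]
    exact hKm.nullMeasurableSet.diff (hF.inter hKm.nullMeasurableSet)
  · refine union_subset ?_ ?_
    · have hsub : D ∩ (closure V)ᶜ ⊆ interior (R \ (A ∪ V) ∪ (· + 1) '' (A ∪ V)) :=
        interior_maximal (fun z hz ↦ Or.inl ⟨hDR hz.1, fun h ↦ hz.2 (hEcl h)⟩)
          (hDo.inter isClosed_closure.isOpen_compl)
      refine Subset.trans ?_ (closure_mono hsub)
      rintro z ⟨hzR, hz⟩
      by_cases hzD : z ∈ D
      · refine hDo.inter_closure ⟨hzD, ?_⟩
        rw [closure_compl]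
        have : interior (closure V) ⊆ V := interior_mono
          (closure_minimal interior_subset isClosed_closure)
        exact fun h ↦ hz (Or.inr (this h))
      · exact inter_comm D _ ▸ isClosed_closure.isOpen_compl.inter_closure
          ⟨fun h ↦ hzD (hVcl h), hRD hzR⟩
    · have hsub : (· + 1) '' V ⊆ interior (R \ (A ∪ V) ∪ (· + 1) '' (A ∪ V)) :=
        interior_maximal ((image_mono subset_union_right).trans subset_union_right)
          ((Homeomorph.addRight (1 : ℂ)).isOpenMap _ isOpen_interior)
      refine Subset.trans ?_ (closure_mono hsub)
      exact (image_mono hEcl).trans (image_closure_subset_closure_image (by fun_prop))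
end
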